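/- Let Y be a real random variable such that E exp(s|Y|) ≤ 20 exp((5/2) s²) for every s ≥ 0. Then E exp( |Y² − 1| / 100 ) < 9. -/

import Mathlib

open MeasureTheory ProbabilityTheory

lemma lintegral_exp_neg_mul_sq {b : ℝ} (hb : 0 < b) :
    ∫⁻ x : ℝ, ENNReal.ofReal (Real.exp (-b * x ^ 2)) = ENNReal.ofReal (√(Real.pi / b)) := by
  rw [← integral_gaussian, ofReal_integral_eq_lintegral_ofReal (integrable_exp_neg_mul_sq hb)]
  exact Filter.Eventually.of_forall fun x => (Real.exp_pos _).le

/-- Completing the square: the Gaussian integral of `x ↦ exp (x c)`. -/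
lemma lintegral_exp_neg_mul_sq_mul_exp_mul {b : ℝ} (hb : 0 < b) (c : ℝ) :
    ∫⁻ x : ℝ, ENNReal.ofReal (Real.exp (-b * x ^ 2)) * ENNReal.ofReal (Real.exp (x * c)) =
      ENNReal.ofReal (Real.exp (c ^ 2 / (4 * b))) * ENNReal.ofReal (√(Real.pi / b)) := by
  rw [← lintegral_exp_neg_mul_sq hb,
    ← lintegral_sub_right_eq_self (fun x : ℝ => ENNReal.ofReal (Real.exp (-b * x ^ 2))) (c / (2 * b)),
    ← lintegral_const_mul _ (by fun_prop)]
  refine lintegral_congr fun x => ?_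
  rw [← ENNReal.ofReal_mul (Real.exp_pos _).le, ← ENNReal.ofReal_mul (Real.exp_pos _).le,
    ← Real.exp_add, ← Real.exp_add]
  congr 2
  field_simp
  ring

lemma lintegral_exp_sq_div_fifty_le {Ω : Type*} [MeasurableSpace Ω] (μ : Measure Ω) [SFinite μ]
    {Y : Ω → ℝ} (hY : Measurable Y)
    (h : ∀ s : ℝ, 0 ≤ s →
      ∫⁻ ω, ENNReal.ofReal (Real.exp (s * |Y ω|)) ∂μ ≤
        ENNReal.ofReal (20 * Real.exp ((5 / 2) * s ^ 2))) :
    ∫⁻ ω, ENNReal.ofReal (Real.exp ((Y ω) ^ 2 / 50)) ∂μ ≤ 24 := by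
  set G := ENNReal.ofReal (√(Real.pi / (25 / 2))) with hG
  have hG0 : G ≠ 0 := by
    rw [hG, Ne, ENNReal.ofReal_eq_zero, not_le]
    positivity
  have key : (∫⁻ ω, ENNReal.ofReal (Real.exp ((Y ω) ^ 2 / 50)) ∂μ) * G ≤ 24 * G := by
    calc (∫⁻ ω, ENNReal.ofReal (Real.exp ((Y ω) ^ 2 / 50)) ∂μ) * G
        = ∫⁻ ω, ∫⁻ x : ℝ, ENNReal.ofReal (Real.exp (-(25 / 2) * x ^ 2)) *
            ENNReal.ofReal (Real.exp (x * |Y ω|)) ∂volume ∂μ := by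
          rw [← lintegral_mul_const _ (by fun_prop)]
          refine lintegral_congr fun ω => ?_
          rw [lintegral_exp_neg_mul_sq_mul_exp_mul (by norm_num), sq_abs]
          norm_num [hG]
      _ = ∫⁻ x : ℝ, ∫⁻ ω, ENNReal.ofReal (Real.exp (-(25 / 2) * x ^ 2)) *
            ENNReal.ofReal (Real.exp (x * |Y ω|)) ∂μ := by
          refine lintegral_lintegral_swap (Measurable.aemeasurable ?_)
          have hm : Measurable fun p : Ω × ℝ => |Y p.1| := (hY.comp measurable_fst).abs
          simp only [Function.uncurry_def]
          fun_prop
      _ ≤ ∫⁻ x : ℝ, 20 * ENNReal.ofReal (Real.exp (-10 * x ^ 2)) := by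
          refine lintegral_mono fun x => ?_
          have hx : ∫⁻ ω, ENNReal.ofReal (Real.exp (x * |Y ω|)) ∂μ ≤
              ENNReal.ofReal (20 * Real.exp ((5 / 2) * x ^ 2)) := by
            rw [← sq_abs x]
            refine le_trans (lintegral_mono fun ω => ?_) (h |x| (abs_nonneg x))
            gcongr
            exact le_abs_self x
          have hm : Measurable fun ω => |Y ω| := hY.abs
          rw [lintegral_const_mul _ (by fun_prop)]
          refine (mul_le_mul_right hx _).trans (le_of_eq ?_)
          rw [← ENNReal.ofReal_mul (Real.exp_pos _).le, mul_left_comm, ← Real.exp_add,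
            ENNReal.ofReal_mul (by norm_num), ENNReal.ofReal_ofNat]
          congr 3
          ring
      _ = 20 * ENNReal.ofReal (√(Real.pi / 10)) := by
          rw [lintegral_const_mul _ (by fun_prop), lintegral_exp_neg_mul_sq (by norm_num)]
      _ ≤ 24 * G := by
          rw [hG, ← ENNReal.ofReal_ofNat 20, ← ENNReal.ofReal_ofNat 24,
            ← ENNReal.ofReal_mul (by norm_num), ← ENNReal.ofReal_mul (by norm_num)]
          refine ENNReal.ofReal_le_ofReal ?_
          have hs : √(Real.pi / 10) ≤ 6 / 5 * √(Real.pi / (25 / 2)) := by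
            rw [Real.sqrt_le_left (by positivity), mul_pow, Real.sq_sqrt (by positivity)]
            linarith [Real.pi_pos]
          linarith
  exact (ENNReal.mul_le_mul_iff_left hG0 ENNReal.ofReal_ne_top).1 key

lemma exp_abs_sq_sub_one_div_le (y : ℝ) :
    Real.exp (|y ^ 2 - 1| / 100) ≤ (1 / 8) * Real.exp (y ^ 2 / 50) + 25 / 8 := by
  have h1 : Real.exp (1 / 100) ≤ 5 / 4 := by
    have := Real.exp_bound_div_one_sub_of_interval (x := 1 / 100) (by norm_num) (by norm_num)
    linarith
  have h2 : |y ^ 2 - 1| / 100 ≤ 1 / 100 + y ^ 2 / 100 := by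
    have : |y ^ 2 - 1| ≤ 1 + y ^ 2 := abs_le.2 ⟨by nlinarith, by nlinarith⟩
    linarith
  have h3 : Real.exp (y ^ 2 / 50) = Real.exp (y ^ 2 / 100) ^ 2 := by
    rw [← Real.exp_nat_mul]
    congr 1
    push_cast
    ring
  calc Real.exp (|y ^ 2 - 1| / 100) ≤ Real.exp (1 / 100) * Real.exp (y ^ 2 / 100) := by
        rw [← Real.exp_add]
        exact Real.exp_le_exp.2 h2
    _ ≤ 5 / 4 * Real.exp (y ^ 2 / 100) := by gcongr
    _ ≤ _ := by
        rw [h3]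
        nlinarith [sq_nonneg (Real.exp (y ^ 2 / 100) - 5)]

/-- If a real random variable `Y` satisfies `E exp(s|Y|) ≤ 20 exp((5/2)s²)` for every
`s ≥ 0`, then `E exp(|Y² - 1|/100) < 9`. -/
theorem psi_two_tail_implies_square_psi_one
    (Ω : Type*) [MeasureSpace Ω] [IsProbabilityMeasure (ℙ : Measure Ω)]
    (Y : Ω → ℝ) (hY : Measurable Y)
    (h : ∀ s : ℝ, 0 ≤ s →
      ∫⁻ ω, ENNReal.ofReal (Real.exp (s * |Y ω|)) ∂ℙ ≤
        ENNReal.ofReal (20 * Real.exp ((5 / 2) * s ^ 2))) :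
    ∫⁻ ω, ENNReal.ofReal (Real.exp (|(Y ω) ^ 2 - 1| / 100)) ∂ℙ < 9 := by
  calc ∫⁻ ω, ENNReal.ofReal (Real.exp (|(Y ω) ^ 2 - 1| / 100)) ∂ℙ
      ≤ ∫⁻ ω, (ENNReal.ofReal (1 / 8) * ENNReal.ofReal (Real.exp ((Y ω) ^ 2 / 50)) +
          ENNReal.ofReal (25 / 8)) ∂ℙ := by
        refine lintegral_mono fun ω => ?_
        rw [← ENNReal.ofReal_mul (by norm_num),
          ← ENNReal.ofReal_add (by positivity) (by norm_num)]
        exact ENNReal.ofReal_le_ofReal (exp_abs_sq_sub_one_div_le _)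
    _ = ENNReal.ofReal (1 / 8) * ∫⁻ ω, ENNReal.ofReal (Real.exp ((Y ω) ^ 2 / 50)) ∂ℙ +
          ENNReal.ofReal (25 / 8) := by
        rw [lintegral_add_right _ measurable_const, lintegral_const_mul _ (by fun_prop)]
        simp
    _ ≤ ENNReal.ofReal (1 / 8) * 24 + ENNReal.ofReal (25 / 8) := by
        gcongr
        exact lintegral_exp_sq_div_fifty_le ℙ hY h
    _ < 9 := by
        rw [← ENNReal.ofReal_ofNat 24, ← ENNReal.ofReal_ofNat 9,
          ← ENNReal.ofReal_mul (by norm_num), ← ENNReal.ofReal_add (by norm_num) (by norm_num)]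
        exact (ENNReal.ofReal_lt_ofReal_iff (by norm_num)).2 (by norm_num)
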